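/- Let λ̂₀ satisfy λ̂₀‖ε̂‖_n ≥ ‖Xᵀε‖_∞/n, let λ > λ̂₀, and set L̂ := (λ+λ̂₀)/(λ−λ̂₀). Then for every β ∈ ℝᵖ with active set S := S_β such that φ̂(L̂,S) > 0, the square-root Lasso β̂ satisfies ‖X(β̂−β⁰)‖_n² ≤ ‖X(β−β⁰)‖_n² + (λ+λ̂₀)²‖ε̂‖_n²·|S| / φ̂²(L̂,S). -/

import Mathlib

open Finset Matrix

/-- `‖v‖_n = √(vᵀv/n)`. -/
noncomputable def normN {n : ℕ} (v : Fin n → ℝ) : ℝ :=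
  Real.sqrt ((∑ i, v i ^ 2) / n)

/-- `ℓ₁`-norm of a vector. -/
noncomputable def l1norm {p : ℕ} (v : Fin p → ℝ) : ℝ := ∑ j, |v j|

/-- `ℓ_∞`-norm of a vector. -/
noncomputable def lsup {p : ℕ} (v : Fin p → ℝ) : ℝ := ⨆ j, |v j|

/-- `β_S`: the vector `β` with entries outside `S` set to zero. -/
def sub0 {p : ℕ} (S : Finset (Fin p)) (β : Fin p → ℝ) : Fin p → ℝ :=
  fun j => if j ∈ S then β j else 0

/-- The compatibility constant squared `φ̂²(L,S)`. -/
noncomputable def compatSq {n p : ℕ} (X : Matrix (Fin n) (Fin p) ℝ) (L : ℝ)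
    (S : Finset (Fin p)) : ℝ :=
  sInf { r | ∃ β : Fin p → ℝ, l1norm (sub0 S β) = 1 ∧ l1norm (sub0 Sᶜ β) ≤ L ∧
    r = S.card * (normN (X.mulVec (sub0 S β) - X.mulVec (sub0 Sᶜ β))) ^ 2 }

theorem normN_nonneg {n : ℕ} (v : Fin n → ℝ) : 0 ≤ normN v := Real.sqrt_nonneg _

theorem normN_sq {n : ℕ} (v : Fin n → ℝ) : normN v ^ 2 = (v ⬝ᵥ v) / n := by
  have h : ∑ i, v i ^ 2 = v ⬝ᵥ v := by simp [dotProduct, sq]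
  rw [normN, Real.sq_sqrt (by positivity), h]

theorem eq_zero_of_normN_eq_zero {n : ℕ} {v : Fin n → ℝ} (h : normN v = 0) : v = 0 := by
  rcases Nat.eq_zero_or_pos n with rfl | hn
  · exact Subsingleton.elim _ _
  · have hn' : (n : ℝ) ≠ 0 := by positivity
    have h2 := normN_sq v
    rw [h, eq_comm, zero_pow two_ne_zero, div_eq_zero_iff, or_iff_left hn',
      dotProduct_self_eq_zero] at h2
    exact h2

theorem abs_le_lsup {p : ℕ} (v : Fin p → ℝ) (j : Fin p) : |v j| ≤ lsup v :=
  le_ciSup (f := fun j => |v j|) (Set.finite_range _).bddAbove j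

theorem lsup_nonneg {p : ℕ} (v : Fin p → ℝ) : 0 ≤ lsup v :=
  Real.iSup_nonneg fun _ => abs_nonneg _

theorem l1norm_nonneg {p : ℕ} (v : Fin p → ℝ) : 0 ≤ l1norm v :=
  Finset.sum_nonneg fun _ _ => abs_nonneg _

theorem l1norm_smul {p : ℕ} (c : ℝ) (v : Fin p → ℝ) : l1norm (c • v) = |c| * l1norm v := by
  simp [l1norm, abs_mul, Finset.mul_sum]

theorem l1norm_add_le {p : ℕ} (v w : Fin p → ℝ) : l1norm (v + w) ≤ l1norm v + l1norm w := by
  rw [l1norm, l1norm, l1norm, ← Finset.sum_add_distrib]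
  exact Finset.sum_le_sum fun j _ => abs_add_le _ _

theorem dotProduct_le_lsup_mul_l1norm {p : ℕ} (v w : Fin p → ℝ) :
    v ⬝ᵥ w ≤ lsup v * l1norm w := by
  rw [dotProduct, l1norm, Finset.mul_sum]
  refine Finset.sum_le_sum fun j _ => (le_abs_self _).trans ?_
  rw [abs_mul]
  exact mul_le_mul_of_nonneg_right (abs_le_lsup v j) (abs_nonneg _)

theorem dotProduct_mulVec_div_le {n p : ℕ} (X : Matrix (Fin n) (Fin p) ℝ) (ε : Fin n → ℝ)
    (δ : Fin p → ℝ) : (ε ⬝ᵥ X *ᵥ δ) / n ≤ lsup (Xᵀ *ᵥ ε) / n * l1norm δ := by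
  rw [div_mul_eq_mul_div]
  gcongr
  rw [dotProduct_mulVec, ← mulVec_transpose]
  exact dotProduct_le_lsup_mul_l1norm _ _

theorem sub0_smul {p : ℕ} (S : Finset (Fin p)) (c : ℝ) (v : Fin p → ℝ) :
    sub0 S (c • v) = c • sub0 S v := by
  ext j; simp [sub0]

theorem l1norm_sub0_add_l1norm_sub0_compl {p : ℕ} (S : Finset (Fin p)) (v : Fin p → ℝ) :
    l1norm (sub0 S v) + l1norm (sub0 Sᶜ v) = l1norm v := by
  rw [l1norm, l1norm, l1norm, ← Finset.sum_add_distrib]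
  refine Finset.sum_congr rfl fun j _ => ?_
  by_cases h : j ∈ S <;> simp [sub0, h]

/-- If `β` is supported on `S`, moving to `β + δ` lowers the `ℓ₁`-norm by at most the mass of `δ`
on `S` minus its mass off `S`. -/
theorem l1norm_sub_l1norm_add_le {p : ℕ} (S : Finset (Fin p)) (β δ : Fin p → ℝ)
    (hβ : ∀ j, j ∉ S → β j = 0) :
    l1norm β - l1norm (β + δ) ≤ l1norm (sub0 S δ) - l1norm (sub0 Sᶜ δ) := by
  simp only [l1norm, ← Finset.sum_sub_distrib]
  refine Finset.sum_le_sum fun j _ => ?_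
  by_cases h : j ∈ S
  · have := abs_sub_abs_le_abs_sub (β j) (β j + δ j)
    simpa [sub0, h] using this
  · simp [sub0, h, hβ j h]

/-- The defining inequality of the compatibility constant, in homogeneous form. -/
theorem compatSq_mul_sq_le {n p : ℕ} (X : Matrix (Fin n) (Fin p) ℝ) (L : ℝ) (S : Finset (Fin p))
    (δ : Fin p → ℝ) (hpos : 0 < l1norm (sub0 S δ))
    (hcone : l1norm (sub0 Sᶜ δ) ≤ L * l1norm (sub0 S δ)) :
    compatSq X L S * l1norm (sub0 S δ) ^ 2 ≤ S.card * normN (X *ᵥ δ) ^ 2 := by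
  set x := l1norm (sub0 S δ) with hx
  have hSflip : sub0 S (sub0 S δ - sub0 Sᶜ δ) = sub0 S δ := by
    ext j; by_cases h : j ∈ S <;> simp [sub0, h]
  have hcflip : sub0 Sᶜ (sub0 S δ - sub0 Sᶜ δ) = (-1 : ℝ) • sub0 Sᶜ δ := by
    ext j; by_cases h : j ∈ S <;> simp [sub0, h]
  have hsum : sub0 S δ + sub0 Sᶜ δ = δ := by
    ext j; by_cases h : j ∈ S <;> simp [sub0, h]
  have hdiff : X *ᵥ (x⁻¹ • sub0 S δ) - X *ᵥ (x⁻¹ • (-1 : ℝ) • sub0 Sᶜ δ)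
      = x⁻¹ • (X *ᵥ δ) := by
    rw [← mulVec_sub, ← smul_sub, neg_one_smul, sub_neg_eq_add, hsum, mulVec_smul]
  have hle : compatSq X L S ≤ S.card * normN (x⁻¹ • (X *ᵥ δ)) ^ 2 := by
    refine csInf_le ⟨0, ?_⟩ ⟨x⁻¹ • (sub0 S δ - sub0 Sᶜ δ), ?_, ?_, ?_⟩
    · rintro r ⟨b, -, -, rfl⟩
      positivity
    · rw [sub0_smul, hSflip, l1norm_smul, ← hx, abs_of_pos (inv_pos.2 hpos),
        inv_mul_cancel₀ hpos.ne']
    · rw [sub0_smul, hcflip, l1norm_smul, l1norm_smul, abs_of_pos (inv_pos.2 hpos), abs_neg,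
        abs_one, one_mul, inv_mul_le_iff₀ hpos, mul_comm]
      exact hcone
    · rw [sub0_smul, sub0_smul, hSflip, hcflip, hdiff]
  have hscale : normN (x⁻¹ • (X *ᵥ δ)) ^ 2 * x ^ 2 = normN (X *ᵥ δ) ^ 2 := by
    rw [normN_sq, normN_sq, smul_dotProduct, dotProduct_smul, smul_eq_mul, smul_eq_mul]
    field_simp
  calc compatSq X L S * x ^ 2 ≤ S.card * normN (x⁻¹ • (X *ᵥ δ)) ^ 2 * x ^ 2 := by gcongr
    _ = S.card * normN (X *ᵥ δ) ^ 2 := by rw [mul_assoc, hscale]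

/-- First-order optimality condition (variational form) of the square-root Lasso at a solution with
nonzero residual. -/
theorem sqrt_lasso_first_order {n p : ℕ} (X : Matrix (Fin n) (Fin p) ℝ) (Y : Fin n → ℝ)
    {lam : ℝ} (hlam : 0 ≤ lam) (βhat : Fin p → ℝ)
    (hmin : ∀ β : Fin p → ℝ, normN (Y - X *ᵥ βhat) + lam * l1norm βhat ≤
      normN (Y - X *ᵥ β) + lam * l1norm β)
    (hpos : 0 < normN (Y - X *ᵥ βhat)) (β : Fin p → ℝ) :
    ((Y - X *ᵥ βhat) ⬝ᵥ X *ᵥ (β - βhat)) / n ≤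
      normN (Y - X *ᵥ βhat) * (lam * (l1norm β - l1norm βhat)) := by
  set e := Y - X *ᵥ βhat with he
  set w := X *ᵥ (β - βhat) with hw
  set s := normN e with hs
  set D := lam * (l1norm β - l1norm βhat) with hD
  have hnear : ∀ᶠ t : ℝ in nhdsWithin 0 (Set.Ioi 0),
      (e ⬝ᵥ w) / n ≤ s * D + t * ((normN w ^ 2 - D ^ 2) / 2) := by
    have hsmall : ∀ᶠ t : ℝ in nhdsWithin 0 (Set.Ioi 0), 0 < s - t * D := by
      have hc : Filter.Tendsto (fun t : ℝ => s - t * D) (nhdsWithin 0 (Set.Ioi 0))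
          (nhds (s - 0 * D)) :=
        (Continuous.tendsto (by fun_prop) 0).mono_left nhdsWithin_le_nhds
      exact hc.eventually_const_lt (by simpa using hpos)
    filter_upwards [hsmall, Ioo_mem_nhdsGT (zero_lt_one' ℝ)] with t hts ht
    obtain ⟨ht0, ht1⟩ := ht
    have hres : Y - X *ᵥ ((1 - t) • βhat + t • β) = e - t • w := by
      rw [he, hw, show (1 - t) • βhat + t • β = βhat + t • (β - βhat) by module, mulVec_add,
        mulVec_smul, sub_sub]
    have hconv : l1norm ((1 - t) • βhat + t • β) ≤ (1 - t) * l1norm βhat + t * l1norm β := by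
      refine (l1norm_add_le _ _).trans_eq ?_
      rw [l1norm_smul, l1norm_smul, abs_of_pos ht0, abs_of_pos (sub_pos.2 ht1)]
    have hle : s - t * D ≤ normN (e - t • w) := by
      have h := hmin ((1 - t) • βhat + t • β)
      rw [hres] at h
      have h2 := mul_le_mul_of_nonneg_left hconv hlam
      rw [hD]
      linarith
    have hsq : (s - t * D) ^ 2 ≤ normN (e - t • w) ^ 2 := by gcongr
    have hexp : normN (e - t • w) ^ 2 = s ^ 2 - 2 * t * ((e ⬝ᵥ w) / n) + t ^ 2 * normN w ^ 2 := by
      rw [hs, normN_sq, normN_sq, normN_sq]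
      simp only [sub_dotProduct, dotProduct_sub, smul_dotProduct, dotProduct_smul, smul_eq_mul,
        dotProduct_comm w e]
      ring
    rw [hexp] at hsq
    refine le_of_mul_le_mul_left ?_ ht0
    linarith
  have hlim : Filter.Tendsto (fun t : ℝ => s * D + t * ((normN w ^ 2 - D ^ 2) / 2))
      (nhdsWithin 0 (Set.Ioi 0)) (nhds (s * D + 0 * ((normN w ^ 2 - D ^ 2) / 2))) :=
    (Continuous.tendsto (by fun_prop) 0).mono_left nhdsWithin_le_nhds
  simpa using ge_of_tendsto hlim hnear

theorem sqrt_lasso_sharp_oracle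
    {n p : ℕ} (X : Matrix (Fin n) (Fin p) ℝ) (Y : Fin n → ℝ)
    (β0 : Fin p → ℝ) (ε : Fin n → ℝ) (hε : ε = Y - X.mulVec β0)
    (lam : ℝ) (hlam0 : 0 < lam)
    (βhat : Fin p → ℝ)
    (hβhat : ∀ β : Fin p → ℝ,
      normN (Y - X.mulVec βhat) + lam * l1norm βhat ≤
        normN (Y - X.mulVec β) + lam * l1norm β)
    (εhat : Fin n → ℝ) (hεhat : εhat = Y - X.mulVec βhat)
    (lamhat0 : ℝ) (hlamhat0 : lamhat0 * normN εhat ≥ lsup (Xᵀ.mulVec ε) / n)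
    (hlam : lam > lamhat0)
    (L : ℝ) (hL : L = (lam + lamhat0) / (lam - lamhat0))
    (β : Fin p → ℝ) (S : Finset (Fin p)) (hS : ∀ j, j ∈ S ↔ β j ≠ 0)
    (hφ : 0 < compatSq X L S) :
    (normN (X.mulVec (βhat - β0))) ^ 2 ≤
      (normN (X.mulVec (β - β0))) ^ 2 +
        (lam + lamhat0) ^ 2 * (normN εhat) ^ 2 * S.card / compatSq X L S := by
  have hdual : ∀ δ : Fin p → ℝ, (ε ⬝ᵥ X *ᵥ δ) / n ≤ lamhat0 * normN εhat * l1norm δ := fun δ =>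
    (dotProduct_mulVec_div_le X ε δ).trans
      (mul_le_mul_of_nonneg_right hlamhat0 (l1norm_nonneg δ))
  have hu : X *ᵥ (βhat - β0) = ε - εhat := by
    rw [hε, hεhat, mulVec_sub]
    abel
  have hextra : 0 ≤ (lam + lamhat0) ^ 2 * (normN εhat) ^ 2 * S.card / compatSq X L S := by
    positivity
  rcases (normN_nonneg εhat).eq_or_lt with hzero | hpos
  · have he : εhat = 0 := eq_zero_of_normN_eq_zero hzero.symm
    have h := hdual (βhat - β0)
    rw [← hzero, hu, he, sub_zero, mul_zero, zero_mul] at h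
    have h2 := sq_nonneg (normN (X *ᵥ (β - β0)))
    have h3 := normN_sq ε
    rw [← hzero] at hextra ⊢
    rw [hu, he, sub_zero]
    linarith
  · have hl0 : 0 ≤ lamhat0 := by
      refine nonneg_of_mul_nonneg_left (b := normN εhat) ?_ hpos
      exact (div_nonneg (lsup_nonneg _) n.cast_nonneg).trans hlamhat0
    have hfo := sqrt_lasso_first_order X Y hlam0.le βhat hβhat (hεhat ▸ hpos) β
    rw [← hεhat] at hfo
    set s := normN εhat with hs
    set δ := βhat - β with hδ
    have hd := hdual δ
    have hl1 := l1norm_sub_l1norm_add_le S β δ fun j hj => by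
      by_contra h
      exact hj ((hS j).2 h)
    rw [show β + δ = βhat by rw [hδ]; abel] at hl1
    have hsplit := l1norm_sub0_add_l1norm_sub0_compl S δ
    set x := l1norm (sub0 S δ) with hx
    set y := l1norm (sub0 Sᶜ δ) with hy
    have hx0 : 0 ≤ x := l1norm_nonneg _
    have hy0 : 0 ≤ y := l1norm_nonneg _
    have hpolar : normN (X *ᵥ (βhat - β0)) ^ 2 + normN (X *ᵥ δ) ^ 2 =
        normN (X *ᵥ (β - β0)) ^ 2 +
          2 * ((ε ⬝ᵥ X *ᵥ δ) / n + (εhat ⬝ᵥ X *ᵥ (β - βhat)) / n) := by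
      have hw : X *ᵥ (β - βhat) = -(X *ᵥ δ) := by
        rw [← mulVec_neg, hδ, neg_sub]
      have hb : X *ᵥ (β - β0) = ε - εhat - X *ᵥ δ := by
        rw [← hu, ← mulVec_sub, hδ]
        congr 1
        abel
      rw [hw, hb, hu, normN_sq, normN_sq, normN_sq]
      simp only [sub_dotProduct, dotProduct_sub, dotProduct_neg, dotProduct_comm (X *ᵥ δ),
        dotProduct_comm εhat ε]
      ring
    have hbound : (ε ⬝ᵥ X *ᵥ δ) / n + (εhat ⬝ᵥ X *ᵥ (β - βhat)) / n ≤
        s * ((lam + lamhat0) * x - (lam - lamhat0) * y) := by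
      have h := mul_le_mul_of_nonneg_left hl1 (mul_pos hpos hlam0).le
      rw [← hsplit] at hd
      linarith
    have hV := sq_nonneg (normN (X *ᵥ δ))
    have hgap : 0 < lam - lamhat0 := sub_pos.2 hlam
    rcases le_or_gt ((lam + lamhat0) * x) ((lam - lamhat0) * y) with hout | hin
    · have h := mul_nonneg hpos.le (sub_nonneg.2 hout)
      linarith
    · have hxpos : 0 < x := by
        refine pos_of_mul_pos_right (a := lam + lamhat0) ?_ (by linarith)
        exact (mul_nonneg hgap.le hy0).trans_lt hin
      have hcone : y ≤ L * x := by
        rw [hL, div_mul_eq_mul_div, le_div_iff₀ hgap, mul_comm y]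
        exact hin.le
      have hcompat := compatSq_mul_sq_le X L S δ hxpos hcone
      set φ := compatSq X L S with hφdef
      have hcard : 0 < (S.card : ℝ) := by
        refine pos_of_mul_pos_left ((by positivity : 0 < φ * x ^ 2).trans_le hcompat) hV
      have hyoung : 2 * (s * (lam + lamhat0) * x) ≤
          (lam + lamhat0) ^ 2 * s ^ 2 * S.card / φ + φ * x ^ 2 / S.card := by
        rw [div_add_div _ _ hφ.ne' hcard.ne', le_div_iff₀ (mul_pos hφ hcard)]
        nlinarith [sq_nonneg ((lam + lamhat0) * s * S.card - φ * x)]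
      have hdiv : φ * x ^ 2 / S.card ≤ normN (X *ᵥ δ) ^ 2 := by
        rw [div_le_iff₀ hcard, mul_comm _ (S.card : ℝ)]
        exact hcompat
      have hdrop : 0 ≤ s * ((lam - lamhat0) * y) := by positivity
      linarith
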